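/- Fix n ≥ 2 and 1 ≤ k ≤ n−1. Let α_j = Σ_{i=0}^{j−2} 9^i, let N = 2·3^{2n−1}, let a = α_{k+1}, b = α_k + 3^{2k−1}, and δ = b − a = 2·3^{2k−2}. Define d_C : ℤ → ℕ by: d_C(t) = 3^{2k−1} + δ if t ≡ a (mod N); d_C(t) = 3^{2k+1} − δ if t ≡ b (mod N); and otherwise d_C(t) = 3^{2j−1} if t ≡ α_j (mod 3^{2j−1}) for some j ∈ {1,…,n}, and d_C(t) = 0 if no such j exists. Then the map C⁻¹_{k,n} : ℤ → ℤ, C⁻¹_{k,n}(t) = t + d_C(t), is a bijection of ℤ; i.e., C⁻¹_{k,n} is a valid juggling pattern. -/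

import Mathlib

/-- `jugAlpha k = Σ_{j=0}^{k-2} 9^j` is the first throw time of the `k`-th
ball in the trivial juggling pattern. -/
def jugAlpha (k : ℕ) : ℕ := ∑ j ∈ Finset.range (k - 1), 9 ^ j

lemma jugAlpha_add_two (m : ℕ) : jugAlpha (m + 2) = jugAlpha (m + 1) + 9 ^ m := by
  simp [jugAlpha, Finset.sum_range_succ]

lemma three_pow_two_mul_succ_sub_one (m : ℕ) : 3 ^ (2 * (m + 1) - 1) = 3 * 9 ^ m := by
  rw [show 2 * (m + 1) - 1 = 2 * m + 1 by omega, pow_succ, pow_mul]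
  ring

lemma exists_jugAlpha_eq_add (p r : ℕ) :
    ∃ q, jugAlpha (p + r + 2) = jugAlpha (p + 1) + 9 ^ p * (1 + 3 * q) := by
  induction r with
  | zero => exact ⟨0, by simp [jugAlpha_add_two]⟩
  | succ r ih =>
    obtain ⟨q, hq⟩ := ih
    refine ⟨q + 3 * 9 ^ r, ?_⟩
    rw [show p + (r + 1) + 2 = (p + r + 1) + 2 by omega, jugAlpha_add_two,
      show p + r + 1 + 1 = p + r + 2 by omega, hq]
    ring

/-- The residue classes of the balls of the trivial pattern are pairwise disjoint. -/
lemma not_modEq_jugAlpha_of_lt {i j : ℕ} (hi : 1 ≤ i) (hij : i < j) {t : ℤ}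
    (hti : t ≡ (jugAlpha i : ℤ) [ZMOD (3 : ℤ) ^ (2 * i - 1)]) :
    ¬ t ≡ (jugAlpha j : ℤ) [ZMOD (3 : ℤ) ^ (2 * j - 1)] := by
  intro htj
  obtain ⟨p, rfl⟩ := Nat.exists_eq_add_of_le' hi
  obtain ⟨r, rfl⟩ := Nat.exists_eq_add_of_lt hij
  obtain ⟨q, hq⟩ := exists_jugAlpha_eq_add p r
  have h := hti.symm.trans (htj.of_dvd (pow_dvd_pow 3 (by omega)))
  have h3 : (3 : ℤ) ^ (2 * (p + 1) - 1) = 3 * 9 ^ p := by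
    exact_mod_cast three_pow_two_mul_succ_sub_one p
  rw [show p + 1 + r + 1 = p + r + 2 by omega, hq, h3] at h
  obtain ⟨c, hc⟩ := h.dvd
  push_cast at hc
  have h9 : (9 : ℤ) ^ p ≠ 0 := by positivity
  have : 1 + 3 * (q : ℤ) = 3 * c := mul_left_cancel₀ h9 (by linear_combination hc)
  omega

lemma eq_of_modEq_jugAlpha {i j : ℕ} (hi : 1 ≤ i) (hj : 1 ≤ j) {t : ℤ}
    (hti : t ≡ (jugAlpha i : ℤ) [ZMOD (3 : ℤ) ^ (2 * i - 1)])
    (htj : t ≡ (jugAlpha j : ℤ) [ZMOD (3 : ℤ) ^ (2 * j - 1)]) : i = j := by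
  rcases lt_trichotomy i j with h | h | h
  · exact absurd htj (not_modEq_jugAlpha_of_lt hi h hti)
  · exact h
  · exact absurd hti (not_modEq_jugAlpha_of_lt hj h htj)

lemma bijective_add_of_invariant {e : ℤ → ℤ} (hadd : ∀ t, e (t + e t) = e t)
    (hsub : ∀ t, e (t - e t) = e t) : Function.Bijective fun t => t + e t := by
  refine ⟨fun s t h => ?_, fun t => ⟨t - e t, by simp [hsub]⟩⟩
  have he : e s = e t := by rw [← hadd s, ← hadd t]; exact congrArg e h
  simpa [he] using h

/-- The trivial pattern exists and is a valid juggling pattern. -/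
lemma exists_trivial_pattern (n : ℕ) : ∃ e : ℤ → ℤ,
    (∀ t j, 1 ≤ j → j ≤ n → t ≡ (jugAlpha j : ℤ) [ZMOD (3 : ℤ) ^ (2 * j - 1)] →
      e t = 3 ^ (2 * j - 1)) ∧
    (∀ t, (∀ j, 1 ≤ j → j ≤ n → ¬ t ≡ (jugAlpha j : ℤ) [ZMOD (3 : ℤ) ^ (2 * j - 1)]) →
      e t = 0) ∧
    Function.Bijective fun t => t + e t := by
  have hex : ∀ t : ℤ, ∃ v : ℤ,
      (∀ j, 1 ≤ j → j ≤ n → t ≡ (jugAlpha j : ℤ) [ZMOD (3 : ℤ) ^ (2 * j - 1)] →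
        v = 3 ^ (2 * j - 1)) ∧
      ((∀ j, 1 ≤ j → j ≤ n → ¬ t ≡ (jugAlpha j : ℤ) [ZMOD (3 : ℤ) ^ (2 * j - 1)]) →
        v = 0) := by
    intro t
    by_cases h : ∃ j, 1 ≤ j ∧ j ≤ n ∧ t ≡ (jugAlpha j : ℤ) [ZMOD (3 : ℤ) ^ (2 * j - 1)]
    · obtain ⟨j, hj1, hjn, hj⟩ := h
      exact ⟨3 ^ (2 * j - 1), fun i hi _ hti => by rw [eq_of_modEq_jugAlpha hi hj1 hti hj],
        fun h => absurd hj (h j hj1 hjn)⟩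
    · exact ⟨0, fun j hj1 hjn hj => absurd ⟨j, hj1, hjn, hj⟩ h, fun _ => rfl⟩
  choose e he he0 using hex
  refine ⟨e, he, he0, bijective_add_of_invariant (fun t => ?_) fun t => ?_⟩ <;>
  by_cases h : ∃ j, 1 ≤ j ∧ j ≤ n ∧ t ≡ (jugAlpha j : ℤ) [ZMOD (3 : ℤ) ^ (2 * j - 1)]
  · obtain ⟨j, hj1, hjn, hj⟩ := h
    rw [he t j hj1 hjn hj]
    exact he _ j hj1 hjn (Int.add_modEq_right.trans hj)
  · rw [he0 t fun j hj1 hjn hj => h ⟨j, hj1, hjn, hj⟩, add_zero]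
    exact he0 t fun j hj1 hjn hj => h ⟨j, hj1, hjn, hj⟩
  · obtain ⟨j, hj1, hjn, hj⟩ := h
    rw [he t j hj1 hjn hj]
    exact he _ j hj1 hjn ((Int.modEq_iff_dvd.2 (by simp)).trans hj)
  · rw [he0 t fun j hj1 hjn hj => h ⟨j, hj1, hjn, hj⟩, sub_zero]
    exact he0 t fun j hj1 hjn hj => h ⟨j, hj1, hjn, hj⟩

/-- Exchanging the residue class of `a` with that of `a + δ` is an involution. -/
lemma exists_involutive_swap_classes {N a b δ : ℤ} (hb : b = a + δ)
    (hab : ¬ a ≡ b [ZMOD N]) : ∃ σ : ℤ → ℤ, Function.Involutive σ ∧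
      (∀ t, t ≡ a [ZMOD N] → σ t = t + δ) ∧ (∀ t, t ≡ b [ZMOD N] → σ t = t - δ) ∧
      ∀ t, ¬ t ≡ a [ZMOD N] → ¬ t ≡ b [ZMOD N] → σ t = t := by
  subst hb
  have hna : ∀ t, t ≡ a + δ [ZMOD N] → ¬ t ≡ a [ZMOD N] := fun t h h' => hab (h'.symm.trans h)
  have hsub : ∀ t, t ≡ a + δ [ZMOD N] → t - δ ≡ a [ZMOD N] := fun t h => by
    simpa using h.sub_right δ
  refine ⟨fun t => if t ≡ a [ZMOD N] then t + δ else if t ≡ a + δ [ZMOD N] then t - δ else t,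
    fun t => ?_, fun t h => if_pos h, fun t h => by simp [hna t h, h],
    fun t h h' => by simp [h, h']⟩
  by_cases h : t ≡ a [ZMOD N]
  · have h' := h.add_right δ
    simp [h, h', hna _ h']
  · by_cases h' : t ≡ a + δ [ZMOD N]
    · simp [h, h', hsub t h']
    · simp [h, h']

/-- The under-crossing pattern `C⁻¹_{k,n}`, obtained from the trivial pattern
`I_n` by swapping (once per fundamental chamber of length `N = 2·3^{2n−1}`)
the sites at `a = α_{k+1}` and `b = α_k + 3^{2k−1}` (so `δ = b − a =
2·3^{2k−2}`), is a bijection of `ℤ`, i.e. a valid juggling pattern. -/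
theorem under_crossing_pattern_bijective (n k : ℕ) (hn : 2 ≤ n)
    (hk1 : 1 ≤ k) (hkn : k ≤ n - 1)
    (N a b δ : ℕ) (hN : N = 2 * 3 ^ (2 * n - 1))
    (ha : a = jugAlpha (k + 1)) (hb : b = jugAlpha k + 3 ^ (2 * k - 1))
    (hδ : δ = b - a) (hδ' : δ = 2 * 3 ^ (2 * k - 2))
    (d : ℤ → ℕ)
    (hda : ∀ t : ℤ, t ≡ (a : ℤ) [ZMOD (N : ℤ)] → d t = 3 ^ (2 * k - 1) + δ)
    (hdb : ∀ t : ℤ, t ≡ (b : ℤ) [ZMOD (N : ℤ)] → d t = 3 ^ (2 * k + 1) - δ)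
    (hdo : ∀ t : ℤ, ¬ t ≡ (a : ℤ) [ZMOD (N : ℤ)] → ¬ t ≡ (b : ℤ) [ZMOD (N : ℤ)] →
      ∀ j : ℕ, 1 ≤ j → j ≤ n →
        t ≡ (jugAlpha j : ℤ) [ZMOD (3 : ℤ) ^ (2 * j - 1)] → d t = 3 ^ (2 * j - 1))
    (hd0 : ∀ t : ℤ, ¬ t ≡ (a : ℤ) [ZMOD (N : ℤ)] → ¬ t ≡ (b : ℤ) [ZMOD (N : ℤ)] →
      (∀ j : ℕ, 1 ≤ j → j ≤ n →
        ¬ t ≡ (jugAlpha j : ℤ) [ZMOD (3 : ℤ) ^ (2 * j - 1)]) → d t = 0) :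
    Function.Bijective (fun t : ℤ => t + (d t : ℤ)) := by
  obtain ⟨m, rfl⟩ := Nat.exists_eq_add_of_le' hk1
  obtain ⟨e, he, he0, hbij⟩ := exists_trivial_pattern n
  have hpow : 3 ^ (2 * (m + 1) - 2) = 9 ^ m := by
    rw [show 2 * (m + 1) - 2 = 2 * m by omega, pow_mul]
    norm_num
  have hba : b = a + δ := by
    rw [ha, hb, hδ', hpow, three_pow_two_mul_succ_sub_one, jugAlpha_add_two]
    ring
  have hpos : 0 < δ := by rw [hδ']; positivity
  have hδN : δ < N := by
    rw [hδ', hN]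
    have : 3 ^ (2 * (m + 1) - 2) < 3 ^ (2 * n - 1) := Nat.pow_lt_pow_right (by omega) (by omega)
    omega
  have hδle : δ ≤ 3 ^ (2 * (m + 1) + 1) := by
    rw [hδ', hpow, show 2 * (m + 1) + 1 = 2 * (m + 2) - 1 by omega,
      three_pow_two_mul_succ_sub_one (m + 1), pow_succ]
    omega
  have hab : ¬ (a : ℤ) ≡ (b : ℤ) [ZMOD (N : ℤ)] := by
    intro h
    have h' := h.dvd
    rw [hba, Nat.cast_add, add_sub_cancel_left, Int.natCast_dvd_natCast] at h'
    exact absurd (Nat.le_of_dvd hpos h') (by omega)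
  have hdvd : ∀ j, j ≤ n → (3 : ℤ) ^ (2 * j - 1) ∣ (N : ℤ) := by
    intro j hj
    rw [hN]
    push_cast
    exact Dvd.dvd.mul_left (pow_dvd_pow 3 (by omega)) 2
  have hea : ∀ t : ℤ, t ≡ (a : ℤ) [ZMOD (N : ℤ)] → e t = 3 ^ (2 * (m + 1) + 1) := by
    intro t ht
    have h := ht.of_dvd (hdvd (m + 2) (by omega))
    rw [ha] at h
    exact he t (m + 2) (by omega) (by omega) h
  have heb : ∀ t : ℤ, t ≡ (b : ℤ) [ZMOD (N : ℤ)] → e t = 3 ^ (2 * (m + 1) - 1) := by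
    intro t ht
    have h := ht.of_dvd (hdvd (m + 1) (by omega))
    rw [hb] at h
    push_cast at h
    exact he t (m + 1) (by omega) (by omega) (h.trans Int.add_modEq_right)
  obtain ⟨σ, hσ, hσa, hσb, hσo⟩ :=
    exists_involutive_swap_classes (N := N) (a := a) (b := b) (δ := δ) (by exact_mod_cast hba) hab
  convert hbij.comp hσ.bijective using 1
  funext t
  simp only [Function.comp_apply]
  by_cases hta : t ≡ (a : ℤ) [ZMOD (N : ℤ)]
  · rw [hda t hta, hσa t hta, heb _ (by rw [hba]; push_cast; exact hta.add_right _)]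
    push_cast
    ring
  by_cases htb : t ≡ (b : ℤ) [ZMOD (N : ℤ)]
  · have h : t - δ ≡ (a : ℤ) [ZMOD (N : ℤ)] := by
      simpa [hba] using htb.sub_right (δ : ℤ)
    rw [hdb t htb, hσb t htb, hea _ h, Nat.cast_sub hδle]
    push_cast
    ring
  rw [hσo t hta htb]
  by_cases h : ∃ j, 1 ≤ j ∧ j ≤ n ∧ t ≡ (jugAlpha j : ℤ) [ZMOD (3 : ℤ) ^ (2 * j - 1)]
  · obtain ⟨j, hj1, hjn, hj⟩ := h
    rw [hdo t hta htb j hj1 hjn hj, he t j hj1 hjn hj]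
    push_cast
    rfl
  · have h' : ∀ j, 1 ≤ j → j ≤ n → ¬ t ≡ (jugAlpha j : ℤ) [ZMOD (3 : ℤ) ^ (2 * j - 1)] :=
      fun j hj1 hjn hj => h ⟨j, hj1, hjn, hj⟩
    rw [hd0 t hta htb h', he0 t h']
    rfl
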